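/- Let P be a convex-ranged probability charge on an algebra Σ and let γ ∈ (0, 1/2]. Define set functions (g_t)_{t ∈ ℕ₀} on Σ recursively by: g_0(A) = 1 if P(A) ≥ γ and g_0(A) = 0 otherwise; and for t ≥ 1, g_t(A) = min( sup_{B ∈ Σ} inf_{C ∈ Σ, C ⊆ Aᶜ} { g_{t−1}(A ∪ B) + g_{t−1}(A ∪ C) − g_{t−1}(B ∪ C) }, 1 ). Then for every t ∈ ℕ₀: (i) for all A, A′ ∈ Σ, P(A) ≤ P(A′) implies g_t(A) ≤ g_t(A′); (ii) g_t(∅) = 0; and (iii) g_t(A) = 1 if P(A) ≥ 2^{−t}·γ and g_t(A) = 0 otherwise. -/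

import Mathlib

/-- A bounded signed charge on the algebra `S` of subsets of `Ω`: a finitely additive,
bounded real-valued set function, normalised to vanish outside `S`. -/
structure Charge {Ω : Type*} (S : Set (Set Ω)) where
  toFun : Set Ω → ℝ
  zero_of_not_mem : ∀ A : Set Ω, A ∉ S → toFun A = 0
  additive : ∀ A B : Set Ω, A ∈ S → B ∈ S → Disjoint A B → toFun (A ∪ B) = toFun A + toFun B
  bounded : ∃ C : ℝ, ∀ A : Set Ω, |toFun A| ≤ C

namespace Charge

variable {Ω : Type*} {S : Set (Set Ω)}

theorem ext' {μ ν : Charge S} (h : μ.toFun = ν.toFun) : μ = ν := by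
  cases μ; cases ν; simpa using h

noncomputable instance : SMul ℝ (Charge S) :=
  ⟨fun a μ =>
    { toFun := fun A => a * μ.toFun A
      zero_of_not_mem := fun A hA => by
        show a * μ.toFun A = 0
        rw [μ.zero_of_not_mem A hA, mul_zero]
      additive := fun A B hA hB hAB => by
        show a * μ.toFun (A ∪ B) = a * μ.toFun A + a * μ.toFun B
        rw [μ.additive A B hA hB hAB]; ring
      bounded := by
        obtain ⟨C, hC⟩ := μ.bounded
        refine ⟨|a| * C, fun A => ?_⟩
        show |a * μ.toFun A| ≤ |a| * C
        rw [abs_mul]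
        exact mul_le_mul_of_nonneg_left (hC A) (abs_nonneg a) }⟩

@[simp] theorem smul_toFun (a : ℝ) (μ : Charge S) (A : Set Ω) :
    (a • μ).toFun A = a * μ.toFun A := rfl

/-- The setwise (partial) order on bounded charges. -/
instance : PartialOrder (Charge S) where
  le μ ν := ∀ A ∈ S, μ.toFun A ≤ ν.toFun A
  le_refl μ A _ := le_refl _
  le_trans μ ν ξ h1 h2 A hA := le_trans (h1 A hA) (h2 A hA)
  le_antisymm μ ν h1 h2 := ext' (funext fun A => by
    by_cases hA : A ∈ S
    · exact le_antisymm (h1 A hA) (h2 A hA)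
    · rw [μ.zero_of_not_mem A hA, ν.zero_of_not_mem A hA])

theorem le_def {μ ν : Charge S} : μ ≤ ν ↔ ∀ A ∈ S, μ.toFun A ≤ ν.toFun A := Iff.rfl

end Charge

/-- A probability charge: nonnegative, with total mass one. -/
def IsProbCharge {Ω : Type*} {S : Set (Set Ω)} (P : Charge S) : Prop :=
  P.toFun Set.univ = 1 ∧ ∀ A : Set Ω, 0 ≤ P.toFun A

/-- A charge `P` has convex range if for every `A ∈ S` the set of values `P(B)`,
`B ∈ S`, `B ⊆ A`, is the full interval `[0, P(A)]`. -/
def HasConvexRange {Ω : Type*} {S : Set (Set Ω)} (P : Charge S) : Prop :=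
  ∀ A ∈ S, {x : ℝ | ∃ B ∈ S, B ⊆ A ∧ P.toFun B = x} = Set.Icc 0 (P.toFun A)

/-- The loose anticore of a set function `v`. -/
def LooseAnticore {Ω : Type*} {S : Set (Set Ω)} (v : Set Ω → ℝ) : Set (Charge S) :=
  {μ | ∀ A ∈ S, μ.toFun A ≤ v A}

/-- The anticore of a set function `v`. -/
def Anticore {Ω : Type*} {S : Set (Set Ω)} (v : Set Ω → ℝ) : Set (Charge S) :=
  {μ | μ ∈ LooseAnticore v ∧ μ.toFun Set.univ = v Set.univ}

/-- The loose core of a set function `v`. -/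
def LooseCore {Ω : Type*} {S : Set (Set Ω)} (v : Set Ω → ℝ) : Set (Charge S) :=
  {μ | ∀ A ∈ S, v A ≤ μ.toFun A}

/-- The core of a set function `v`. -/
def Core {Ω : Type*} {S : Set (Set Ω)} (v : Set Ω → ℝ) : Set (Charge S) :=
  {μ | μ ∈ LooseCore v ∧ μ.toFun Set.univ = v Set.univ}

/-- The recursive family of set functions `(g_t)` built from the right-VaR capacity
`g_0(A) = 1` iff `P(A) ≥ γ`. -/
noncomputable def gseq {Ω : Type*} {S : Set (Set Ω)} (P : Charge S) (γ : ℝ) :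
    ℕ → Set Ω → ℝ
  | 0 => fun A => if γ ≤ P.toFun A then 1 else 0
  | t + 1 => fun A =>
      min (sSup {x : ℝ | ∃ B ∈ S,
        x = sInf {y : ℝ | ∃ C ∈ S, C ⊆ Aᶜ ∧
          y = gseq P γ t (A ∪ B) + gseq P γ t (A ∪ C) - gseq P γ t (B ∪ C)}}) 1

namespace Charge

variable {Ω : Type*} {S : Set (Set Ω)}

theorem toFun_empty (hS : MeasureTheory.IsSetAlgebra S) (P : Charge S) : P.toFun ∅ = 0 := by
  have h := P.additive ∅ ∅ hS.empty_mem hS.empty_mem (Set.disjoint_empty _)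
  rw [Set.union_empty] at h
  linarith

theorem toFun_compl (hS : MeasureTheory.IsSetAlgebra S) (P : Charge S) {A : Set Ω} (hA : A ∈ S) :
    P.toFun A + P.toFun Aᶜ = P.toFun Set.univ := by
  rw [← P.additive A Aᶜ hA (hS.compl_mem hA) disjoint_compl_right, Set.union_compl_self]

theorem toFun_union (hS : MeasureTheory.IsSetAlgebra S) (P : Charge S) {A B : Set Ω}
    (hA : A ∈ S) (hB : B ∈ S) : P.toFun (A ∪ B) = P.toFun A + P.toFun (B \ A) := by
  rw [← P.additive A (B \ A) hA (hS.sdiff_mem hB hA) Set.disjoint_sdiff_right,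
    Set.union_sdiff_self]

theorem toFun_mono (hS : MeasureTheory.IsSetAlgebra S) {P : Charge S} (hP : IsProbCharge P)
    {A B : Set Ω} (hA : A ∈ S) (hB : B ∈ S) (h : A ⊆ B) : P.toFun A ≤ P.toFun B := by
  have h1 := P.toFun_union hS hA hB
  rw [Set.union_eq_self_of_subset_left h] at h1
  linarith [hP.2 (B \ A)]

theorem toFun_union_le (hS : MeasureTheory.IsSetAlgebra S) {P : Charge S} (hP : IsProbCharge P)
    {A B : Set Ω} (hA : A ∈ S) (hB : B ∈ S) : P.toFun (A ∪ B) ≤ P.toFun A + P.toFun B := by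
  rw [P.toFun_union hS hA hB]
  linarith [Charge.toFun_mono hS hP (hS.sdiff_mem hB hA) hB Set.sdiff_subset]

end Charge

section ThresholdStep

variable {Ω : Type*} {S : Set (Set Ω)} {P : Charge S} {δ : ℝ} {u : Set Ω → ℝ} {A B : Set Ω}

/-- The values over which the infimum in the recursion for `gseq` is taken. -/
def exchangeValues (S : Set (Set Ω)) (u : Set Ω → ℝ) (A B : Set Ω) : Set ℝ :=
  {y : ℝ | ∃ C ∈ S, C ⊆ Aᶜ ∧ y = u (A ∪ B) + u (A ∪ C) - u (B ∪ C)}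

theorem exchangeValues_nonempty (hS : MeasureTheory.IsSetAlgebra S) :
    (exchangeValues S u A B).Nonempty :=
  ⟨_, ∅, hS.empty_mem, Set.empty_subset _, rfl⟩

theorem exchangeValues_subset_Icc (hS : MeasureTheory.IsSetAlgebra S)
    (hu : ∀ A ∈ S, u A = if δ ≤ P.toFun A then 1 else 0) (hA : A ∈ S) (hB : B ∈ S) :
    exchangeValues S u A B ⊆ Set.Icc (-1) 2 := by
  rintro y ⟨C, hC, -, rfl⟩
  rw [hu _ (hS.union_mem hA hB), hu _ (hS.union_mem hA hC), hu _ (hS.union_mem hB hC)]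
  constructor <;> split_ifs <;> norm_num

theorem bddBelow_exchangeValues (hS : MeasureTheory.IsSetAlgebra S)
    (hu : ∀ A ∈ S, u A = if δ ≤ P.toFun A then 1 else 0) (hA : A ∈ S) (hB : B ∈ S) :
    BddBelow (exchangeValues S u A B) :=
  bddBelow_Icc.mono (exchangeValues_subset_Icc hS hu hA hB)

theorem exists_one_le_sInf_exchangeValues (hS : MeasureTheory.IsSetAlgebra S)
    (hP : IsProbCharge P) (hPcr : HasConvexRange P) (hδ' : δ ≤ 1 / 2)
    (hu : ∀ A ∈ S, u A = if δ ≤ P.toFun A then 1 else 0) (hA : A ∈ S)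
    (h : δ / 2 ≤ P.toFun A) : ∃ B ∈ S, 1 ≤ sInf (exchangeValues S u A B) := by
  rcases le_or_gt δ (P.toFun A) with h1 | h1
  · refine ⟨∅, hS.empty_mem, le_csInf (exchangeValues_nonempty hS) ?_⟩
    rintro y ⟨C, hC, -, rfl⟩
    rw [Set.union_empty, Set.empty_union, hu _ hA, hu _ (hS.union_mem hA hC), hu _ hC,
      if_pos h1,
      if_pos (h1.trans (Charge.toFun_mono hS hP hA (hS.union_mem hA hC) Set.subset_union_left))]
    split_ifs <;> norm_num
  · have hcompl := P.toFun_compl hS hA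
    rw [hP.1] at hcompl
    have hmem : δ - P.toFun A ∈ Set.Icc 0 (P.toFun Aᶜ) := ⟨by linarith, by linarith⟩
    rw [← hPcr _ (hS.compl_mem hA)] at hmem
    obtain ⟨B, hB, hBA, hPB⟩ := hmem
    refine ⟨B, hB, le_csInf (exchangeValues_nonempty hS) ?_⟩
    rintro y ⟨C, hC, hCA, rfl⟩
    have hAB := P.additive A B hA hB (Set.disjoint_left.2 fun x hx hxB => hBA hxB hx)
    have hAC := P.additive A C hA hC (Set.disjoint_left.2 fun x hx hxC => hCA hxC hx)
    have hBC := Charge.toFun_union_le hS hP hB hC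
    rw [hu _ (hS.union_mem hA hB), hu _ (hS.union_mem hA hC), hu _ (hS.union_mem hB hC),
      if_pos (by linarith)]
    split_ifs <;> linarith

theorem sInf_exchangeValues_nonpos (hS : MeasureTheory.IsSetAlgebra S)
    (hP : IsProbCharge P) (hPcr : HasConvexRange P) (hδ : 0 < δ) (hδ' : δ ≤ 1 / 2)
    (hu : ∀ A ∈ S, u A = if δ ≤ P.toFun A then 1 else 0) (hA : A ∈ S) (hB : B ∈ S)
    (h : P.toFun A < δ / 2) : sInf (exchangeValues S u A B) ≤ 0 := by
  suffices ∃ C ∈ S, C ⊆ Aᶜ ∧ u (A ∪ B) + u (A ∪ C) - u (B ∪ C) ≤ 0 by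
    obtain ⟨C, hC, hCA, hle⟩ := this
    exact (csInf_le (bddBelow_exchangeValues hS hu hA hB) ⟨C, hC, hCA, rfl⟩).trans hle
  have hABm := hS.union_mem hA hB
  by_cases h1 : P.toFun (A ∪ B) < δ ∨ δ ≤ P.toFun B
  · refine ⟨∅, hS.empty_mem, Set.empty_subset _, ?_⟩
    rw [Set.union_empty, Set.union_empty, hu _ hABm, hu _ hA, hu _ hB,
      if_neg (show ¬ δ ≤ P.toFun A by linarith)]
    rcases h1 with h1 | h1
    · rw [if_neg h1.not_ge]
      split_ifs <;> norm_num
    · rw [if_pos h1]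
      split_ifs <;> norm_num
  · obtain ⟨h2, h3⟩ := not_or.1 h1
    have hsub := Charge.toFun_union_le hS hP hA hB
    have hcompl := P.toFun_compl hS hABm
    rw [hP.1] at hcompl
    have hmem : δ - P.toFun B ∈ Set.Icc 0 (P.toFun (A ∪ B)ᶜ) := ⟨by linarith, by linarith⟩
    rw [← hPcr _ (hS.compl_mem hABm)] at hmem
    obtain ⟨C, hC, hCAB, hPC⟩ := hmem
    refine ⟨C, hC, fun x hx hxA => hCAB hx (Or.inl hxA), ?_⟩
    have hBC := P.additive B C hB hC
      (Set.disjoint_left.2 fun x hx hxC => hCAB hxC (Or.inr hx))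
    have hAC := Charge.toFun_union_le hS hP hA hC
    rw [hu _ hABm, hu _ (hS.union_mem hA hC), hu _ (hS.union_mem hB hC),
      if_neg (show ¬ δ ≤ P.toFun (A ∪ C) by linarith),
      if_pos (show δ ≤ P.toFun (B ∪ C) by linarith)]
    split_ifs <;> norm_num

theorem sInf_exchangeValues_empty_nonneg (hS : MeasureTheory.IsSetAlgebra S)
    (hP : IsProbCharge P) (hu : ∀ A ∈ S, u A = if δ ≤ P.toFun A then 1 else 0) (hA : A ∈ S) :
    0 ≤ sInf (exchangeValues S u A ∅) := by
  refine le_csInf (exchangeValues_nonempty hS) ?_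
  rintro y ⟨C, hC, -, rfl⟩
  have hmono := Charge.toFun_mono hS hP hC (hS.union_mem hA hC) Set.subset_union_right
  rw [Set.union_empty, Set.empty_union, hu _ hA, hu _ (hS.union_mem hA hC), hu _ hC]
  split_ifs <;> linarith

theorem min_sSup_sInf_exchangeValues (hS : MeasureTheory.IsSetAlgebra S)
    (hP : IsProbCharge P) (hPcr : HasConvexRange P) (hδ : 0 < δ) (hδ' : δ ≤ 1 / 2)
    (hu : ∀ A ∈ S, u A = if δ ≤ P.toFun A then 1 else 0) (hA : A ∈ S) :
    min (sSup {x : ℝ | ∃ B ∈ S, x = sInf (exchangeValues S u A B)}) 1 =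
      if δ / 2 ≤ P.toFun A then 1 else 0 := by
  split_ifs with h
  · obtain ⟨B, hB, h1⟩ := exists_one_le_sInf_exchangeValues hS hP hPcr hδ' hu hA h
    refine min_eq_right (h1.trans (le_csSup ⟨2, ?_⟩ ⟨B, hB, rfl⟩))
    rintro x ⟨B', hB', rfl⟩
    obtain ⟨y, hy⟩ := exchangeValues_nonempty (u := u) (A := A) (B := B') hS
    exact (csInf_le (bddBelow_exchangeValues hS hu hA hB') hy).trans
      (exchangeValues_subset_Icc hS hu hA hB' hy).2
  · have hle : ∀ x ∈ {x : ℝ | ∃ B ∈ S, x = sInf (exchangeValues S u A B)}, x ≤ 0 := by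
      rintro x ⟨B, hB, rfl⟩
      exact sInf_exchangeValues_nonpos hS hP hPcr hδ hδ' hu hA hB (not_le.1 h)
    have hsup : sSup {x : ℝ | ∃ B ∈ S, x = sInf (exchangeValues S u A B)} = 0 :=
      le_antisymm (csSup_le ⟨_, ∅, hS.empty_mem, rfl⟩ hle)
        ((sInf_exchangeValues_empty_nonneg hS hP hu hA).trans
          (le_csSup ⟨0, hle⟩ ⟨∅, hS.empty_mem, rfl⟩))
    rw [hsup]
    norm_num

end ThresholdStep

theorem gseq_eq_ite {Ω : Type*} {S : Set (Set Ω)} (hS : MeasureTheory.IsSetAlgebra S)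
    {P : Charge S} (hP : IsProbCharge P) (hPcr : HasConvexRange P)
    {γ : ℝ} (hγ : γ ∈ Set.Ioc (0 : ℝ) (1 / 2)) (t : ℕ) :
    ∀ A ∈ S, gseq P γ t A = if (2 : ℝ) ^ (-(t : ℤ)) * γ ≤ P.toFun A then 1 else 0 := by
  induction t with
  | zero => intro A _; simp [gseq]
  | succ t ih =>
    intro A hA
    have hpos : (0 : ℝ) < 2 ^ (-(t : ℤ)) := by positivity
    have hle : (2 : ℝ) ^ (-(t : ℤ)) ≤ 1 :=
      zpow_le_one_of_nonpos₀ (by norm_num) (by simp)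
    have hhalf : (2 : ℝ) ^ (-((t + 1 : ℕ) : ℤ)) * γ = 2 ^ (-(t : ℤ)) * γ / 2 := by
      rw [Nat.cast_succ, neg_add, zpow_add₀ two_ne_zero, zpow_neg_one]
      ring
    rw [hhalf]
    exact min_sSup_sInf_exchangeValues hS hP hPcr (mul_pos hpos hγ.1)
      ((mul_le_of_le_one_left hγ.1.le hle).trans hγ.2) ih hA

/-- For a convex-ranged probability charge `P` on an algebra `S` and
`γ ∈ (0, 1/2]`, the recursively defined set functions `g_t` satisfy: (i) monotonicity in
`P`-probability; (ii) `g_t(∅) = 0`; (iii) `g_t(A) = 1` if `P(A) ≥ 2^{−t}·γ` and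
`g_t(A) = 0` otherwise. -/
theorem stmt14 {Ω : Type*} (S : Set (Set Ω)) (hS : MeasureTheory.IsSetAlgebra S)
    (P : Charge S) (hP : IsProbCharge P) (hPcr : HasConvexRange P)
    (γ : ℝ) (hγ : γ ∈ Set.Ioc (0 : ℝ) (1 / 2)) :
    ∀ t : ℕ,
      (∀ A ∈ S, ∀ A' ∈ S, P.toFun A ≤ P.toFun A' →
        gseq (S := S) P γ t A ≤ gseq (S := S) P γ t A') ∧
      gseq (S := S) P γ t ∅ = 0 ∧
      (∀ A ∈ S, gseq (S := S) P γ t A =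
        if (2 : ℝ) ^ (-(t : ℤ)) * γ ≤ P.toFun A then 1 else 0) := by
  intro t
  have key := gseq_eq_ite hS hP hPcr hγ t
  refine ⟨fun A hA A' hA' hle => ?_, ?_, key⟩
  · rw [key A hA, key A' hA']
    split_ifs <;> linarith
  · have hpos : (0 : ℝ) < 2 ^ (-(t : ℤ)) * γ := mul_pos (by positivity) hγ.1
    rw [key ∅ hS.empty_mem, P.toFun_empty hS, if_neg hpos.not_ge]
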